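/- Let q : (0,∞) → ℂ be measurable with ∫_0^∞ (1+x)|q(x)| dx < ∞, and set Q₀ = (1/2)∫_0^∞ q(x) dx. Then i·k·(ψ(k) − 1) → −Q₀ as |k| → ∞ in the closed upper half-plane: for every ε > 0 there exists R > 0 such that for all k with Im k ≥ 0 and |k| ≥ R one has |i·k·(ψ(k) − 1) + Q₀| < ε. Equivalently, ψ(k) = 1 − (Q₀ + o(1))/(ik) as |k| → ∞ uniformly in arg k ∈ [0,π]. -/

import Mathlib

open MeasureTheory Complex Filter Set

/-- The kernel `G(t,k) = (sin(kt)/k)·e^{ikt}` for `k ≠ 0`, with `G(t,0) = t`. -/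
noncomputable def G (t : ℝ) (k : ℂ) : ℂ :=
  if k = 0 then (t : ℂ) else Complex.sin (k * t) / k * Complex.exp (Complex.I * k * t)

/-- The previous node `t_{j-1}` of the simplex `x = t₀ < t₁ < ⋯ < t_n`. -/
noncomputable def prevNode (x : ℝ) {n : ℕ} (t : Fin n → ℝ) (j : Fin n) : ℝ :=
  if (j : ℕ) = 0 then x
  else t ⟨(j : ℕ) - 1, Nat.lt_of_le_of_lt (Nat.sub_le _ _) j.isLt⟩

/-- The iterated simplex integral
`y_n(x,k) = ∫_{x = t₀ < t₁ < ⋯ < t_n} ∏_{j=1}^n G(t_j − t_{j−1}, k)·q(t_j) dt₁⋯dt_n`. -/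
noncomputable def ysimp (q : ℝ → ℂ) (n : ℕ) (x : ℝ) (k : ℂ) : ℂ :=
  ∫ t : Fin n → ℝ in {t | StrictMono t ∧ ∀ i, x < t i},
    ∏ j, G (t j - prevNode x t j) k * q (t j)

/-- The Jost function `ψ(k) = 1 + ∑_{n ≥ 1} y_n(0,k)`. -/
noncomputable def jost (q : ℝ → ℂ) (k : ℂ) : ℂ :=
  1 + ∑' n : ℕ, ysimp q (n + 1) 0 k

open scoped ContDiff ENNReal

lemma G_eq (t : ℝ) (k : ℂ) (hk : k ≠ 0) :
    Complex.I * k * G t k = (1/2) * (Complex.exp (2 * Complex.I * k * t) - 1) := by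
  unfold G
  rw [if_neg hk, Complex.sin]
  have h1 : Complex.exp (2 * Complex.I * k * t)
      = Complex.exp (Complex.I * k * t) * Complex.exp (Complex.I * k * t) := by
    rw [← Complex.exp_add]; congr 1; ring
  have h2 : Complex.exp (-(Complex.I * k * t)) * Complex.exp (Complex.I * k * t) = 1 := by
    rw [← Complex.exp_add, ← Complex.exp_zero]; congr 1; ring
  have h3 : k * t * Complex.I = Complex.I * k * t := by ring
  rw [h1, h3]
  field_simp
  linear_combination (Complex.I ^ 2) * h2 +
    (1 - Complex.exp (Complex.I * k * t) ^ 2) * Complex.I_sq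

lemma norm_exp_le (t : ℝ) (k : ℂ) (hk : 0 ≤ k.im) (ht : 0 ≤ t) :
    ‖Complex.exp (2 * Complex.I * k * t)‖ ≤ 1 := by
  rw [Complex.norm_exp]
  apply Real.exp_le_one_iff.mpr
  have : (2 * Complex.I * k * t).re = -(2 * (k.im * t)) := by
    simp [Complex.mul_re, Complex.mul_im]; ring
  rw [this]
  have := mul_nonneg hk ht
  linarith

lemma norm_G_le (t : ℝ) (k : ℂ) (hk : 0 ≤ k.im) (hk0 : k ≠ 0) (ht : 0 ≤ t) :
    ‖G t k‖ ≤ ‖k‖⁻¹ := by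
  have h := congrArg norm (G_eq t k hk0)
  have h1 : ‖Complex.exp (2 * Complex.I * k * t) - 1‖ ≤ 1 + 1 :=
    (norm_sub_le _ _).trans (by gcongr; exact norm_exp_le t k hk ht; simp)
  have hpos : 0 < ‖k‖ := norm_pos_iff.mpr hk0
  rw [norm_mul, norm_mul, norm_mul, Complex.norm_I, one_mul] at h
  have h2 : ‖(1/2 : ℂ)‖ = 1/2 := by norm_num
  rw [h2] at h
  rw [← one_div, le_div_iff₀ hpos]
  linarith

lemma measurableSet_simplex (n : ℕ) (x : ℝ) :
    MeasurableSet {t : Fin n → ℝ | StrictMono t ∧ ∀ i, x < t i} := by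
  have : {t : Fin n → ℝ | StrictMono t ∧ ∀ i, x < t i}
      = (⋂ i, ⋂ j, ⋂ _ : i < j, {t : Fin n → ℝ | t i < t j}) ∩ ⋂ i, {t : Fin n → ℝ | x < t i} := by
    ext t
    simp [StrictMono]
  rw [this]
  refine MeasurableSet.inter ?_ ?_
  · refine MeasurableSet.iInter fun i => MeasurableSet.iInter fun j => MeasurableSet.iInter fun _ => ?_
    exact measurableSet_lt (measurable_pi_apply i) (measurable_pi_apply j)
  · refine MeasurableSet.iInter fun i => ?_
    exact measurableSet_lt measurable_const (measurable_pi_apply i)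

lemma prevNode_le {n : ℕ} (t : Fin n → ℝ) (x : ℝ) (h : StrictMono t) (hx : ∀ i, x < t i)
    (j : Fin n) : 0 ≤ t j - prevNode x t j := by
  unfold prevNode
  split_ifs with h0
  · linarith [hx j]
  · have : t ⟨(j : ℕ) - 1, Nat.lt_of_le_of_lt (Nat.sub_le _ _) j.isLt⟩ < t j := by
      apply h
      rw [Fin.lt_def]
      simp only
      omega
    linarith

lemma norm_ysimp_le (q : ℝ → ℂ) (hqi : IntegrableOn q (Set.Ioi 0)) (n : ℕ) (k : ℂ)
    (hk : 0 ≤ k.im) (hk0 : k ≠ 0) :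
    ‖ysimp q n 0 k‖ ≤ ((∫ x in Set.Ioi (0:ℝ), ‖q x‖) / ‖k‖) ^ n := by
  set f : ℝ → ℝ := fun s => ‖k‖⁻¹ * (Set.Ioi (0:ℝ)).indicator (fun s => ‖q s‖) s with hf
  have hfi : Integrable f := by
    apply Integrable.const_mul
    exact (integrable_indicator_iff measurableSet_Ioi).mpr hqi.norm
  have hf0 : ∀ s, 0 ≤ f s := fun s =>
    mul_nonneg (by positivity) (Set.indicator_nonneg (fun _ _ => norm_nonneg _) s)
  have hint : Integrable (fun t : Fin n → ℝ => ∏ j, f (t j)) := 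
    Integrable.fintype_prod (f := fun _ => f) (μ := fun _ => volume) (fun _ => hfi)
  have hval : ∫ t : Fin n → ℝ, ∏ j, f (t j) = ((∫ x in Set.Ioi (0:ℝ), ‖q x‖) / ‖k‖) ^ n := by
    rw [integral_fintype_prod_volume_eq_pow f, Fintype.card_fin, hf, integral_const_mul,
      integral_indicator measurableSet_Ioi, div_eq_inv_mul]
  rw [← hval]
  unfold ysimp
  refine (norm_integral_le_of_norm_le hint.integrableOn ?_).trans
    (setIntegral_le_integral hint (Eventually.of_forall fun t => Finset.prod_nonneg fun j _ => hf0 _))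
  refine ae_restrict_of_forall_mem (measurableSet_simplex n 0) ?_
  rintro t ⟨h1, h2⟩
  rw [norm_prod]
  refine Finset.prod_le_prod (fun _ _ => norm_nonneg _) fun j _ => ?_
  rw [norm_mul, hf]
  simp only
  rw [Set.indicator_of_mem (show t j ∈ Set.Ioi (0:ℝ) from h2 j)]
  gcongr
  exact norm_G_le _ k hk hk0 (prevNode_le t 0 h1 h2 j)

lemma ysimp_one (q : ℝ → ℂ) (k : ℂ) :
    ysimp q 1 0 k = ∫ x in Set.Ioi (0:ℝ), G x k * q x := by
  unfold ysimp
  have key := (volume_preserving_funUnique (Fin 1) ℝ).setIntegral_preimage_emb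
      (MeasurableEquiv.measurableEmbedding _) (fun x => G x k * q x) (Set.Ioi 0)
  rw [← key]
  have : (⇑(MeasurableEquiv.funUnique (Fin 1) ℝ) ⁻¹' Set.Ioi (0:ℝ))
      = {t | StrictMono t ∧ ∀ (i : Fin 1), 0 < t i} := by
    ext x
    simp [MeasurableEquiv.funUnique, Subsingleton.strictMono]
  rw [this]
  simp [MeasurableEquiv.funUnique, prevNode]
  rfl

lemma integrable_exp_mul (f : ℝ → ℂ) (hf : IntegrableOn f (Set.Ioi 0)) (k : ℂ) (hk : 0 ≤ k.im) :
    IntegrableOn (fun x : ℝ => Complex.exp (2 * Complex.I * k * x) * f x) (Set.Ioi 0) := by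
  refine Integrable.bdd_mul (c := 1) hf ?_ ?_
  · exact Continuous.aestronglyMeasurable (by fun_prop)
  · exact ae_restrict_of_forall_mem measurableSet_Ioi fun x hx => norm_exp_le x k hk (le_of_lt hx)

lemma norm_integral_exp_mul_le (f : ℝ → ℂ) (hf : IntegrableOn f (Set.Ioi 0)) (k : ℂ)
    (hk : 0 ≤ k.im) :
    ‖∫ x in Set.Ioi (0:ℝ), Complex.exp (2 * Complex.I * k * x) * f x‖
      ≤ ∫ x in Set.Ioi (0:ℝ), ‖f x‖ := by
  refine norm_integral_le_of_norm_le hf.norm ?_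
  refine ae_restrict_of_forall_mem measurableSet_Ioi fun x hx => ?_
  rw [norm_mul]
  exact mul_le_of_le_one_left (norm_nonneg _) (norm_exp_le x k hk (le_of_lt hx))

lemma smooth_bound (g : ℝ → ℂ) (hg : ContDiff ℝ 1 g) (hc : HasCompactSupport g) (k : ℂ)
    (hk : 0 ≤ k.im) :
    2 * ‖k‖ * ‖∫ x in Set.Ioi (0:ℝ), Complex.exp (2 * Complex.I * k * x) * g x‖
      ≤ ‖g 0‖ + ∫ x in Set.Ioi (0:ℝ), ‖deriv g x‖ := by
  have hgi : IntegrableOn g (Set.Ioi 0) :=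
    (hg.continuous.integrable_of_hasCompactSupport hc).integrableOn
  have hgi' : IntegrableOn (deriv g) (Set.Ioi 0) :=
    ((hg.continuous_deriv le_rfl).integrable_of_hasCompactSupport hc.deriv).integrableOn
  set u : ℝ → ℂ := fun x => Complex.exp (2 * Complex.I * k * x) * g x with hu
  have hud : ContDiff ℝ 1 u := by
    refine ContDiff.mul ?_ hg
    refine ContDiff.cexp ?_
    exact contDiff_const.mul Complex.ofRealCLM.contDiff
  have huc : HasCompactSupport u := hc.mul_left
  have hder : ∀ x : ℝ, deriv u x = (2 * Complex.I * k) * (Complex.exp (2 * Complex.I * k * x) * g x)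
      + Complex.exp (2 * Complex.I * k * x) * deriv g x := by
    intro x
    have h1 : HasDerivAt (fun x : ℝ => (2 * Complex.I * k) * (x : ℂ)) ((2 * Complex.I * k) * 1) x :=
      (Complex.ofRealCLM.hasDerivAt (x := x)).const_mul _
    have h2 := h1.cexp.mul (hg.differentiable one_ne_zero x).hasDerivAt
    rw [HasDerivAt.deriv (f := u) h2]
    ring
  have h := huc.integral_Ioi_deriv_eq hud 0
  simp_rw [hder] at h
  rw [integral_add ((integrable_exp_mul g hgi k hk).const_mul _) (integrable_exp_mul _ hgi' k hk),
    integral_const_mul] at h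
  have hu0 : u 0 = g 0 := by simp [hu]
  rw [hu0] at h
  have h' := congrArg norm (eq_sub_of_add_eq h)
  rw [norm_mul, norm_mul, norm_mul, Complex.norm_I] at h'
  have h3 : ‖(2:ℂ)‖ = 2 := by norm_num
  rw [h3, mul_one] at h'
  rw [h']
  refine (norm_sub_le _ _).trans ?_
  rw [norm_neg]
  gcongr
  exact norm_integral_exp_mul_le _ hgi' k hk

lemma riemann_lebesgue (q : ℝ → ℂ) (hqi : IntegrableOn q (Set.Ioi 0)) (ε : ℝ) (hε : 0 < ε) :
    ∃ R > 0, ∀ k : ℂ, 0 ≤ k.im → R ≤ ‖k‖ →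
      ‖∫ x in Set.Ioi (0:ℝ), Complex.exp (2 * Complex.I * k * x) * q x‖ ≤ ε := by
  obtain ⟨g, hc, hg, hle⟩ := (memLp_one_iff_integrable.mpr hqi).exist_eLpNorm_sub_le
    ENNReal.one_ne_top le_rfl (half_pos hε)
  have hgi : IntegrableOn g (Set.Ioi 0) :=
    (hg.continuous.integrable_of_hasCompactSupport hc).integrableOn
  have hsub : IntegrableOn (q - g) (Set.Ioi 0) := Integrable.sub hqi hgi
  have hle' : ∫ x in Set.Ioi (0:ℝ), ‖(q - g) x‖ ≤ ε / 2 := by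
    rw [integral_norm_eq_lintegral_enorm hsub.aestronglyMeasurable, ← eLpNorm_one_eq_lintegral_enorm]
    exact ENNReal.toReal_le_of_le_ofReal (half_pos hε).le hle
  have hg1 : ContDiff ℝ 1 g := hg.of_le (by exact_mod_cast le_top)
  set C := ‖g 0‖ + ∫ x in Set.Ioi (0:ℝ), ‖deriv g x‖ with hC
  have hC0 : 0 ≤ C := by positivity
  refine ⟨C / ε + 1, by positivity, fun k hk hR => ?_⟩
  have hb := smooth_bound g hg1 hc k hk
  rw [← hC] at hb
  have h1 := norm_integral_exp_mul_le _ hsub k hk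
  have hsplit : ∫ x in Set.Ioi (0:ℝ), Complex.exp (2 * Complex.I * k * x) * q x
      = (∫ x in Set.Ioi (0:ℝ), Complex.exp (2 * Complex.I * k * x) * (q - g) x)
        + ∫ x in Set.Ioi (0:ℝ), Complex.exp (2 * Complex.I * k * x) * g x := by
    rw [← integral_add (integrable_exp_mul _ hsub k hk) (integrable_exp_mul _ hgi k hk)]
    congr 1
    ext x
    simp only [Pi.sub_apply]
    ring
  rw [hsplit]
  refine (norm_add_le _ _).trans ?_
  set N := ‖∫ x in Set.Ioi (0:ℝ), Complex.exp (2 * Complex.I * k * x) * g x‖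
  have hkpos : 0 < ‖k‖ := lt_of_lt_of_le (by positivity) hR
  have hCk : C ≤ ε * ‖k‖ := by
    have : C / ε ≤ ‖k‖ := by linarith
    rw [div_le_iff₀ hε] at this
    linarith
  have hN : N ≤ ε / 2 := by
    by_contra hcon
    push Not at hcon
    have := mul_lt_mul_of_pos_left hcon hkpos
    nlinarith
  linarith

/-- If `q` is measurable with `∫_0^∞ (1+x)|q(x)| dx < ∞` and `Q₀ = (1/2)∫_0^∞ q(x) dx`, then
`i·k·(ψ(k) − 1) → −Q₀` as `|k| → ∞` uniformly in the closed upper half-plane. -/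
theorem jost_asymptotics (q : ℝ → ℂ) (hmq : Measurable q)
    (hq : IntegrableOn (fun x => (1 + x) * ‖q x‖) (Set.Ioi 0)) :
    ∀ ε > 0, ∃ R > 0, ∀ k : ℂ, 0 ≤ k.im → R ≤ ‖k‖ →
      ‖Complex.I * k * (jost q k - 1) + (1/2) * ∫ x in Set.Ioi (0:ℝ), q x‖ < ε := by
  intro ε hε
  have hqi : IntegrableOn q (Set.Ioi 0) := by
    refine Integrable.mono' hq hmq.aestronglyMeasurable ?_
    refine ae_restrict_of_forall_mem measurableSet_Ioi fun x hx => ?_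
    have hx' : (0:ℝ) < x := hx
    nlinarith [norm_nonneg (q x)]
  obtain ⟨R₀, hR₀, hRL⟩ := riemann_lebesgue q hqi (ε / 2) (half_pos hε)
  set A := ∫ x in Set.Ioi (0:ℝ), ‖q x‖ with hA
  have hA0 : 0 ≤ A := by positivity
  refine ⟨R₀ + 2 * A + 4 * A ^ 2 / ε, by positivity, fun k hk hR => ?_⟩
  have hz : 0 ≤ 4 * A ^ 2 / ε := by positivity
  have hRL' := hRL k hk (by linarith)
  have hkpos : 0 < ‖k‖ := by linarith
  have hk0 : k ≠ 0 := norm_pos_iff.mp hkpos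
  set r := A / ‖k‖ with hr
  have hr0 : 0 ≤ r := by positivity
  have hr2 : r ≤ 1 / 2 := by
    rw [hr, div_le_iff₀ hkpos]; linarith
  have hy : ∀ n, ‖ysimp q n 0 k‖ ≤ r ^ n := fun n => norm_ysimp_le q hqi n k hk hk0
  have hgeo : HasSum (fun n : ℕ => r ^ (n + 2)) (r ^ 2 * (1 - r)⁻¹) := by
    have := (hasSum_geometric_of_lt_one hr0 (by linarith : r < 1)).mul_left (r ^ 2)
    refine this.congr_fun ?_ |> id
    intro n; ring
  have hsum : Summable (fun n : ℕ => ysimp q (n + 1) 0 k) := by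
    rw [← summable_nat_add_iff 1]
    exact Summable.of_norm_bounded hgeo.summable fun n => hy (n + 2)
  set T := ∑' n : ℕ, ysimp q (n + 1 + 1) 0 k with hT
  have hTn : ‖T‖ ≤ r ^ 2 * (1 - r)⁻¹ := tsum_of_norm_bounded hgeo fun n => hy (n + 2)
  have hTn2 : ‖k‖ * ‖T‖ ≤ ε / 2 := by
    have h1 : (1 - r)⁻¹ ≤ 2 := by
      rw [inv_le_comm₀ (by linarith) (by norm_num)]; linarith
    have h2 : ‖T‖ ≤ r ^ 2 * 2 := hTn.trans (by gcongr)
    have h3 : ‖k‖ * (r ^ 2 * 2) = 2 * A ^ 2 / ‖k‖ := by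
      rw [hr]; field_simp
    have h4 : 2 * A ^ 2 / ‖k‖ ≤ ε / 2 := by
      rw [div_le_iff₀ hkpos]
      have : 4 * A ^ 2 / ε ≤ ‖k‖ := by linarith
      rw [div_le_iff₀ hε] at this
      linarith
    calc ‖k‖ * ‖T‖ ≤ ‖k‖ * (r ^ 2 * 2) := by gcongr
      _ ≤ ε / 2 := by rw [h3]; exact h4
  have hj : jost q k - 1 = ysimp q 1 0 k + T := by
    unfold jost
    rw [hsum.tsum_eq_zero_add]
    simp [hT]
  have hy1 : Complex.I * k * ysimp q 1 0 k
      = (1/2) * (∫ x in Set.Ioi (0:ℝ), Complex.exp (2 * Complex.I * k * x) * q x)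
        - (1/2) * ∫ x in Set.Ioi (0:ℝ), q x := by
    rw [ysimp_one, ← integral_const_mul, ← mul_sub, ← integral_sub (integrable_exp_mul q hqi k hk) hqi,
      ← integral_const_mul]
    congr 1
    ext x
    linear_combination q x * G_eq x k hk0
  rw [hj, mul_add, hy1]
  set E := ∫ x in Set.Ioi (0:ℝ), Complex.exp (2 * Complex.I * k * x) * q x
  have : (1/2) * E - (1/2) * (∫ x in Set.Ioi (0:ℝ), q x) + Complex.I * k * T
      + (1/2) * (∫ x in Set.Ioi (0:ℝ), q x) = (1/2) * E + Complex.I * k * T := by ring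
  rw [this]
  refine (norm_add_le _ _).trans_lt ?_
  rw [norm_mul, norm_mul, norm_mul, Complex.norm_I, one_mul]
  have h2 : ‖(1/2 : ℂ)‖ = 1/2 := by norm_num
  rw [h2]
  linarith
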